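/- Let p, q, θ ∈ ℝ, let s = cos θ + (kℓ) sin θ ∈ 𝕆, and let A₁ be the 3×3 octonionic matrix !![p, i q, k q s; −i q, p, j q; −k q s, −j q, p]. Then the vectors v = (j, 2 k s, i)ᵀ and w = (j, −k s, i)ᵀ in 𝕆³ satisfy right eigenvalue equations A₁ v = v (p + ε q conj(s)) and A₁ w = w (p − 2 ε q conj(s)) for some sign ε ∈ {1, −1}. -/

import Mathlib

noncomputable section

/-- The octonions, as the Cayley–Dickson double of the quaternions. -/
def Octonion : Type := Quaternion ℝ × Quaternion ℝ

namespace Octonion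

instance : AddCommGroup Octonion :=
  inferInstanceAs (AddCommGroup (Quaternion ℝ × Quaternion ℝ))

instance : Module ℝ Octonion :=
  inferInstanceAs (Module ℝ (Quaternion ℝ × Quaternion ℝ))

/-- Cayley–Dickson multiplication: (a,b)·(c,d) = (a c − conj(d) b, d a + b conj(c)). -/
instance : Mul Octonion :=
  ⟨fun x y => (x.1 * y.1 - star y.2 * x.2, y.2 * x.1 + x.2 * star y.1)⟩

instance : One Octonion := ⟨((1 : Quaternion ℝ), 0)⟩

/-- Octonionic conjugation: conj (a,b) = (conj a, −b). -/
def conj (x : Octonion) : Octonion := (star x.1, -x.2)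

/-- Real part of an octonion. -/
def re (x : Octonion) : ℝ := x.1.re

/-- Imaginary part of an octonion. -/
def im (x : Octonion) : Octonion := x - re x • 1

/-- Embedding of the reals into the octonions. -/
def ofReal (r : ℝ) : Octonion := (((r : ℝ) : Quaternion ℝ), 0)

/-- The squared norm |w|² (the real scalar such that w · conj w = |w|² · 1). -/
def normSq (x : Octonion) : ℝ := Quaternion.normSq x.1 + Quaternion.normSq x.2

/-- The imaginary unit i. -/
def i : Octonion := ((⟨0, 1, 0, 0⟩ : Quaternion ℝ), 0)

/-- The imaginary unit j. -/
def j : Octonion := ((⟨0, 0, 1, 0⟩ : Quaternion ℝ), 0)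

/-- The imaginary unit k. -/
def k : Octonion := ((⟨0, 0, 0, 1⟩ : Quaternion ℝ), 0)

/-- The imaginary unit ℓ. -/
def l : Octonion := ((0 : Quaternion ℝ), (1 : Quaternion ℝ))

/-- The associator [x,y,z] = (xy)z − x(yz). -/
def assoc (x y z : Octonion) : Octonion := x * y * z - x * (y * z)

/-- A Jordan matrix: a 3×3 Hermitian matrix over the octonions. -/
def IsHermitian (A : Matrix (Fin 3) (Fin 3) Octonion) : Prop :=
  ∀ p q : Fin 3, conj (A q p) = A p q

/-- The right eigenvalue equation `A v = v λ`, componentwise. -/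
def Eig (A : Matrix (Fin 3) (Fin 3) Octonion) (v : Fin 3 → Octonion) (lam : Octonion) : Prop :=
  ∀ p : Fin 3, A p 0 * v 0 + A p 1 * v 1 + A p 2 * v 2 = v p * lam

end Octonion

namespace Octonion

@[ext]
theorem ext_parts {x y : Octonion} (h₁ : x.1 = y.1) (h₂ : x.2 = y.2) : x = y :=
  Prod.ext h₁ h₂

theorem fst_mul (x y : Octonion) : (x * y).1 = x.1 * y.1 - star y.2 * x.2 := rfl

theorem snd_mul (x y : Octonion) : (x * y).2 = y.2 * x.1 + x.2 * star y.1 := rfl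

theorem fst_add (x y : Octonion) : (x + y).1 = x.1 + y.1 := rfl

theorem snd_add (x y : Octonion) : (x + y).2 = x.2 + y.2 := rfl

theorem fst_neg (x : Octonion) : (-x).1 = -x.1 := rfl

theorem snd_neg (x : Octonion) : (-x).2 = -x.2 := rfl

theorem fst_smul (r : ℝ) (x : Octonion) : (r • x).1 = r • x.1 := rfl

theorem snd_smul (r : ℝ) (x : Octonion) : (r • x).2 = r • x.2 := rfl

theorem fst_one :
    (1 : Octonion).1.re = 1 ∧ (1 : Octonion).1.imI = 0 ∧ (1 : Octonion).1.imJ = 0 ∧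
      (1 : Octonion).1.imK = 0 :=
  ⟨rfl, rfl, rfl, rfl⟩

theorem snd_one : (1 : Octonion).2 = 0 := rfl

theorem fst_ofReal (r : ℝ) :
    (ofReal r).1.re = r ∧ (ofReal r).1.imI = 0 ∧ (ofReal r).1.imJ = 0 ∧ (ofReal r).1.imK = 0 :=
  ⟨rfl, rfl, rfl, rfl⟩

theorem snd_ofReal (r : ℝ) : (ofReal r).2 = 0 := rfl

theorem fst_conj (x : Octonion) : (conj x).1 = star x.1 := rfl

theorem snd_conj (x : Octonion) : (conj x).2 = -x.2 := rfl

theorem fst_i :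
    i.1.re = 0 ∧ i.1.imI = 1 ∧ i.1.imJ = 0 ∧ i.1.imK = 0 :=
  ⟨rfl, rfl, rfl, rfl⟩

theorem snd_i : i.2 = 0 := rfl

theorem fst_j :
    j.1.re = 0 ∧ j.1.imI = 0 ∧ j.1.imJ = 1 ∧ j.1.imK = 0 :=
  ⟨rfl, rfl, rfl, rfl⟩

theorem snd_j : j.2 = 0 := rfl

theorem fst_k :
    k.1.re = 0 ∧ k.1.imI = 0 ∧ k.1.imJ = 0 ∧ k.1.imK = 1 :=
  ⟨rfl, rfl, rfl, rfl⟩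

theorem snd_k : k.2 = 0 := rfl

theorem fst_l : l.1 = 0 := rfl

theorem snd_l :
    l.2.re = 1 ∧ l.2.imI = 0 ∧ l.2.imJ = 0 ∧ l.2.imK = 0 :=
  ⟨rfl, rfl, rfl, rfl⟩

/-- The quaternion components of `s = c + (kℓ) d`. -/
theorem fst_add_kl (c d : ℝ) :
    let s : Octonion := c • 1 + d • (k * l)
    s.1.re = c ∧ s.1.imI = 0 ∧ s.1.imJ = 0 ∧ s.1.imK = 0 := by
  simp [fst_mul, fst_add, fst_smul, fst_one, snd_k, fst_l]

theorem snd_add_kl (c d : ℝ) :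
    let s : Octonion := c • 1 + d • (k * l)
    s.2.re = 0 ∧ s.2.imI = 0 ∧ s.2.imJ = 0 ∧ s.2.imK = d := by
  simp [snd_mul, snd_add, snd_smul, snd_one, fst_k, snd_k, fst_l, snd_l]

/-- The quaternion components of `k s` for `s = c + (kℓ) d`. -/
theorem fst_k_mul_add_kl (c d : ℝ) :
    let t : Octonion := k * (c • 1 + d • (k * l))
    t.1.re = 0 ∧ t.1.imI = 0 ∧ t.1.imJ = 0 ∧ t.1.imK = c := by
  simp [fst_mul, fst_add_kl, fst_k, snd_k]

theorem snd_k_mul_add_kl (c d : ℝ) :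
    let t : Octonion := k * (c • 1 + d • (k * l))
    t.2.re = -d ∧ t.2.imI = 0 ∧ t.2.imJ = 0 ∧ t.2.imK = 0 := by
  simp [snd_mul, snd_add_kl, fst_k, snd_k]

end Octonion

open Octonion in
/-- The matrix `A₁` with `s = cos θ + kℓ sin θ` admits `v = (j, 2ks, i)ᵀ` and
`w = (j, −ks, i)ᵀ` as eigenvectors with right eigenvalues `p ± q conj(s)` and
`p ∓ 2q conj(s)` respectively. -/
theorem example_one_vw (p q θ : ℝ) :
    ∃ ε : ℝ, (ε = 1 ∨ ε = -1) ∧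
      Eig !![ofReal p, q • i, q • (k * (Real.cos θ • 1 + Real.sin θ • (k * l)));
        -(q • i), ofReal p, q • j;
        -(q • (k * (Real.cos θ • 1 + Real.sin θ • (k * l)))), -(q • j), ofReal p]
        ![j, (2 : ℝ) • (k * (Real.cos θ • 1 + Real.sin θ • (k * l))), i]
        (ofReal p + (ε * q) • conj (Real.cos θ • 1 + Real.sin θ • (k * l))) ∧
      Eig !![ofReal p, q • i, q • (k * (Real.cos θ • 1 + Real.sin θ • (k * l)));
        -(q • i), ofReal p, q • j;
        -(q • (k * (Real.cos θ • 1 + Real.sin θ • (k * l)))), -(q • j), ofReal p]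
        ![j, -(k * (Real.cos θ • 1 + Real.sin θ • (k * l))), i]
        (ofReal p - (2 * ε * q) • conj (Real.cos θ • 1 + Real.sin θ • (k * l))) := by
  have h := Real.sin_sq_add_cos_sq θ
  have hs₁ := fst_add_kl (Real.cos θ) (Real.sin θ)
  have hs₂ := snd_add_kl (Real.cos θ) (Real.sin θ)
  have ht₁ := fst_k_mul_add_kl (Real.cos θ) (Real.sin θ)
  have ht₂ := snd_k_mul_add_kl (Real.cos θ) (Real.sin θ)
  dsimp only at hs₁ hs₂ ht₁ ht₂
  generalize k * (Real.cos θ • (1 : Octonion) + Real.sin θ • (k * l)) = t at *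
  generalize Real.cos θ • (1 : Octonion) + Real.sin θ • (k * l) = s at *
  refine ⟨-1, Or.inr rfl, ?_, ?_⟩
  all_goals
    intro a
    fin_cases a <;> ext <;>
      simp [fst_mul, snd_mul, fst_add, snd_add, fst_neg, snd_neg, fst_smul,
        snd_smul, fst_ofReal, snd_ofReal, fst_conj, snd_conj, fst_i, snd_i, fst_j, snd_j,
        hs₁, hs₂, ht₁, ht₂] <;>
      first
      | ring1
      | linear_combination (2 * q) * h
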